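/- arXiv:1407.0832 — 2 statements merged into one kernel-verified Lean document; each statement's English description precedes it below -/
import Mathlib

section
/- Let (a_i)_{i≥0} be a sequence with a_0 ∈ S_p and a_i ∈ S'_p for all i ≥ 1, and let α be the value of the infinite Ruban continued fraction [a_0, a_1, a_2, …]. Then for every n ≥ 0, |α − r_n/q_n|_p = 1/(|a_{n+1}|_p · |q_n|_p²). -/
open Filter Polynomial

/-- `S_p`: rationals `b` with `b·p^k ∈ ℤ` for some `k ≥ 0` and `0 ≤ b < p`. -/
def Sp (p : ℕ) : Set ℚ :=
  {b : ℚ | (∃ k : ℕ, ∃ z : ℤ, (z : ℚ) = b * (p : ℚ) ^ k) ∧ 0 ≤ b ∧ b < (p : ℚ)}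

/-- `S'_p`: elements of `S_p` with `|b|_p ≥ p`. -/
def Sp' (p : ℕ) : Set ℚ :=
  {b : ℚ | b ∈ Sp p ∧ (p : ℚ) ≤ padicNorm p b}

/-- Denominators of the convergents, with shifted index: `rubanQ a 0 = q_{-1} = 0`,
`rubanQ a 1 = q_0 = 1`, and `rubanQ a (n+1) = q_n = a_n q_{n-1} + q_{n-2}`. -/
def rubanQ (a : ℕ → ℚ) : ℕ → ℚ
  | 0 => 0
  | 1 => 1
  | n + 2 => a (n + 1) * rubanQ a (n + 1) + rubanQ a n

/-- Numerators of the convergents, with shifted index: `rubanR a 0 = r_{-1} = 1`,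
`rubanR a 1 = r_0 = a_0`, and `rubanR a (n+1) = r_n = a_n r_{n-1} + r_{n-2}`. -/
def rubanR (a : ℕ → ℚ) : ℕ → ℚ
  | 0 => 1
  | 1 => a 0
  | n + 2 => a (n + 1) * rubanR a (n + 1) + rubanR a n

/-- `α` is the value of the infinite Ruban continued fraction `[a_0, a_1, …]`, i.e. the
limit in `ℚ_p` of the convergents `r_n / q_n`. -/
def IsRubanValue (p : ℕ) [Fact p.Prime] (a : ℕ → ℚ) (α : ℚ_[p]) : Prop :=
  Filter.Tendsto (fun n : ℕ => ((rubanR a (n + 1) / rubanQ a (n + 1) : ℚ) : ℚ_[p]))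
    Filter.atTop (nhds α)

/-- A sequence is ultimately periodic if `a_{n+l} = a_n` for all `n ≥ k`,
for some `k ≥ 0`, `l ≥ 1`. -/
def UltimatelyPeriodic (a : ℕ → ℚ) : Prop :=
  ∃ k l : ℕ, 1 ≤ l ∧ ∀ n, k ≤ n → a (n + l) = a n

theorem rubanR_mul_rubanQ_sub (a : ℕ → ℚ) (n : ℕ) :
    rubanR a (n + 1) * rubanQ a n - rubanR a n * rubanQ a (n + 1) = (-1) ^ (n + 1) := by
  induction n with
  | zero => simp [rubanR, rubanQ]
  | succ n ih =>
    rw [rubanR, rubanQ, pow_succ, ← ih]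
    ring

section

variable {p : ℕ} [Fact p.Prime] {a : ℕ → ℚ}

theorem one_lt_padicNorm_of_mem_Sp' {b : ℚ} (hb : b ∈ Sp' p) : 1 < padicNorm p b :=
  lt_of_lt_of_le (by exact_mod_cast (Fact.out : p.Prime).one_lt) hb.2

theorem padicNorm_rubanQ_lt_and_eq (ha : ∀ i, 1 ≤ i → a i ∈ Sp' p) (n : ℕ) :
    padicNorm p (rubanQ a n) < padicNorm p (rubanQ a (n + 1)) ∧
      padicNorm p (rubanQ a (n + 2)) =
        padicNorm p (a (n + 1)) * padicNorm p (rubanQ a (n + 1)) := by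
  have key (m : ℕ) (h : padicNorm p (rubanQ a m) < padicNorm p (rubanQ a (m + 1))) :
      padicNorm p (rubanQ a (m + 1)) <
          padicNorm p (a (m + 1)) * padicNorm p (rubanQ a (m + 1)) ∧
        padicNorm p (rubanQ a (m + 2)) =
          padicNorm p (a (m + 1)) * padicNorm p (rubanQ a (m + 1)) := by
    have h1 := lt_mul_of_one_lt_left ((padicNorm.nonneg _).trans_lt h)
      (one_lt_padicNorm_of_mem_Sp' (ha (m + 1) (by omega)))
    refine ⟨h1, ?_⟩
    have h2 : padicNorm p (rubanQ a m) < padicNorm p (a (m + 1) * rubanQ a (m + 1)) := by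
      rw [padicNorm.mul]
      exact h.trans h1
    rw [rubanQ, padicNorm.add_eq_max_of_ne h2.ne', max_eq_left h2.le, padicNorm.mul]
  suffices h : padicNorm p (rubanQ a n) < padicNorm p (rubanQ a (n + 1)) from ⟨h, (key n h).2⟩
  induction n with
  | zero => simp [rubanQ]
  | succ n ih => exact (key n ih).2 ▸ (key n ih).1

theorem padicNorm_rubanQ_pos (ha : ∀ i, 1 ≤ i → a i ∈ Sp' p) (n : ℕ) :
    0 < padicNorm p (rubanQ a (n + 1)) :=
  (padicNorm.nonneg _).trans_lt (padicNorm_rubanQ_lt_and_eq ha n).1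

theorem padicNorm_convergent_succ_sub (ha : ∀ i, 1 ≤ i → a i ∈ Sp' p) (n : ℕ) :
    padicNorm p (rubanR a (n + 2) / rubanQ a (n + 2) - rubanR a (n + 1) / rubanQ a (n + 1)) =
      1 / (padicNorm p (rubanQ a (n + 2)) * padicNorm p (rubanQ a (n + 1))) := by
  have hne (m : ℕ) : rubanQ a (m + 1) ≠ 0 := fun h => by
    simpa [h] using padicNorm_rubanQ_pos ha m
  rw [div_sub_div _ _ (hne (n + 1)) (hne n), mul_comm (rubanQ a (n + 2)) (rubanR a (n + 1)),
    rubanR_mul_rubanQ_sub a (n + 1), padicNorm.div, padicNorm.mul]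
  rcases neg_one_pow_eq_or ℚ (n + 1 + 1) with h | h <;> simp [h]

theorem padicNorm_convergent_sub (ha : ∀ i, 1 ≤ i → a i ∈ Sp' p) (n k : ℕ) :
    padicNorm p (rubanR a (n + k + 2) / rubanQ a (n + k + 2) -
        rubanR a (n + 1) / rubanQ a (n + 1)) =
      1 / (padicNorm p (rubanQ a (n + 2)) * padicNorm p (rubanQ a (n + 1))) := by
  have hmono : StrictMono fun m => padicNorm p (rubanQ a m) :=
    strictMono_nat_of_lt_succ fun m => (padicNorm_rubanQ_lt_and_eq ha m).1
  induction k with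
  | zero => exact padicNorm_convergent_succ_sub ha n
  | succ k ih =>
    have hstep := padicNorm_convergent_succ_sub ha (n + k + 1)
    have hlt : 1 / (padicNorm p (rubanQ a (n + k + 1 + 2)) *
          padicNorm p (rubanQ a (n + k + 1 + 1))) <
        1 / (padicNorm p (rubanQ a (n + 2)) * padicNorm p (rubanQ a (n + 1))) := by
      refine one_div_lt_one_div_of_lt
        (mul_pos (padicNorm_rubanQ_pos ha (n + 1)) (padicNorm_rubanQ_pos ha n)) ?_
      exact mul_lt_mul'' (hmono (by omega)) (hmono (by omega)) (padicNorm.nonneg _)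
        (padicNorm.nonneg _)
    rw [← hstep, ← ih] at hlt
    rw [← ih, ← sub_add_sub_cancel _ (rubanR a (n + k + 2) / rubanQ a (n + k + 2)),
      ← add_assoc n k 1, padicNorm.add_eq_max_of_ne hlt.ne, max_eq_right hlt.le]

end

/-- **Lemma 1, (9).** `|α - r_n/q_n|_p = 1 / (|a_{n+1}|_p |q_n|_p²)` for all `n ≥ 0`. -/
theorem ruban_convergent_dist
    (p : ℕ) [Fact p.Prime]
    (a : ℕ → ℚ) (ha0 : a 0 ∈ Sp p) (ha : ∀ i, 1 ≤ i → a i ∈ Sp' p)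
    (α : ℚ_[p]) (hα : IsRubanValue p a α) (n : ℕ) :
    ‖α - ((rubanR a (n + 1) / rubanQ a (n + 1) : ℚ) : ℚ_[p])‖ =
      1 / ((padicNorm p (a (n + 1)) : ℝ) * (padicNorm p (rubanQ a (n + 1)) : ℝ) ^ 2) := by
  have hq := (padicNorm_rubanQ_lt_and_eq ha n).2
  have hlim := ((hα.sub_const
    ((rubanR a (n + 1) / rubanQ a (n + 1) : ℚ) : ℚ_[p])).norm.comp (tendsto_add_atTop_nat (n + 1)))
  refine tendsto_nhds_unique hlim (tendsto_const_nhds.congr fun k => ?_)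
  have hk := padicNorm_convergent_sub ha n k
  rw [hq] at hk
  have hidx : k + (n + 1) + 1 = n + k + 2 := by omega
  rw [Function.comp_apply, hidx, ← Rat.cast_sub, Padic.eq_padicNorm, hk]
  push_cast
  ring
end

section
/- Let A ≥ p be a real number and let (a_i)_{i≥0} be a sequence with a_0 ∈ S_p and a_i ∈ S'_p for all i ≥ 1 such that |a_i|_p ≤ A for every i ≥ 1. Then for every n ≥ 1, p^n ≤ |q_n|_p ≤ A^n. -/
open Filter Polynomial

theorem padicNorm_add_eq_left_of_lt {p : ℕ} [Fact p.Prime] {x y : ℚ}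
    (h : padicNorm p y < padicNorm p x) : padicNorm p (x + y) = padicNorm p x := by
  rw [padicNorm.add_eq_max_of_ne h.ne', max_eq_left h.le]

/-- The `p`-adic norms of the Ruban denominators strictly increase. -/
theorem padicNorm_rubanQ_lt_succ {p : ℕ} [Fact p.Prime] {a : ℕ → ℚ}
    (ha : ∀ i, 1 ≤ i → 1 < padicNorm p (a i)) (n : ℕ) :
    padicNorm p (rubanQ a n) < padicNorm p (rubanQ a (n + 1)) := by
  induction n with
  | zero => simp [rubanQ]
  | succ n ih =>
    have hpos : 0 < padicNorm p (rubanQ a (n + 1)) := (padicNorm.nonneg _).trans_lt ih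
    have hlt : padicNorm p (rubanQ a (n + 1)) <
        padicNorm p (a (n + 1) * rubanQ a (n + 1)) := by
      rw [padicNorm.mul]
      exact lt_mul_of_one_lt_left hpos (ha _ (Nat.le_add_left 1 n))
    rwa [rubanQ, padicNorm_add_eq_left_of_lt (ih.trans hlt)]

/-- `|q_{n+1}|_p = |a_{n+1}|_p |q_n|_p`, with the index shift of `rubanQ`. -/
theorem padicNorm_rubanQ_add_two {p : ℕ} [Fact p.Prime] {a : ℕ → ℚ}
    (ha : ∀ i, 1 ≤ i → 1 < padicNorm p (a i)) (n : ℕ) :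
    padicNorm p (rubanQ a (n + 2)) =
      padicNorm p (a (n + 1)) * padicNorm p (rubanQ a (n + 1)) := by
  have h := padicNorm_rubanQ_lt_succ ha n
  rw [rubanQ, padicNorm_add_eq_left_of_lt, padicNorm.mul]
  rw [padicNorm.mul]
  exact h.trans_le (le_mul_of_one_le_left (padicNorm.nonneg _) (ha _ (Nat.le_add_left 1 n)).le)

/-- `|q_n|_p = |a_1|_p ⋯ |a_n|_p`, with the index shift of `rubanQ`. -/
theorem padicNorm_rubanQ_succ_eq_prod {p : ℕ} [Fact p.Prime] {a : ℕ → ℚ}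
    (ha : ∀ i, 1 ≤ i → 1 < padicNorm p (a i)) (n : ℕ) :
    padicNorm p (rubanQ a (n + 1)) = ∏ i ∈ Finset.range n, padicNorm p (a (i + 1)) := by
  induction n with
  | zero => simp [rubanQ]
  | succ n ih => rw [padicNorm_rubanQ_add_two ha, ih, Finset.prod_range_succ, mul_comm]

/-- If `|a_i|_p ≤ A` for all `i ≥ 1` (with `A ≥ p`), then `p^n ≤ |q_n|_p ≤ A^n` for all
`n ≥ 1`. (Recall the index shift: `q_n = rubanQ a (n+1)`.) -/
theorem ruban_padicNorm_q_bounds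
    (p : ℕ) [Fact p.Prime] (A : ℝ) (hA : (p : ℝ) ≤ A)
    (a : ℕ → ℚ) (ha0 : a 0 ∈ Sp p) (ha : ∀ i, 1 ≤ i → a i ∈ Sp' p)
    (hbound : ∀ i, 1 ≤ i → (padicNorm p (a i) : ℝ) ≤ A) :
    ∀ n : ℕ, 1 ≤ n →
      (p : ℝ) ^ n ≤ (padicNorm p (rubanQ a (n + 1)) : ℝ) ∧
      (padicNorm p (rubanQ a (n + 1)) : ℝ) ≤ A ^ n := by
  intro n _
  have hp : (1 : ℚ) < p := mod_cast (Fact.out : p.Prime).one_lt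
  rw [padicNorm_rubanQ_succ_eq_prod fun i hi => hp.trans_le (ha i hi).2]
  push_cast
  constructor
  · calc (p : ℝ) ^ n = ∏ _i ∈ Finset.range n, (p : ℝ) := by simp
      _ ≤ _ := Finset.prod_le_prod (fun _ _ => Nat.cast_nonneg p)
        fun i _ => mod_cast (ha (i + 1) (Nat.le_add_left 1 i)).2
  · calc _ ≤ ∏ _i ∈ Finset.range n, A :=
        Finset.prod_le_prod (fun _ _ => mod_cast padicNorm.nonneg _)
          fun i _ => hbound (i + 1) (Nat.le_add_left 1 i)
      _ = A ^ n := by simp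
end
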